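/- Let m ≥ 2, let PSp(2m, ℤ) denote the quotient of Sp(2m, ℤ) by its center, let H be a finite-index subgroup of PSp(2m, ℤ), and let L be a normal subgroup of H such that the quotient group H/L is nilpotent. Then L has finite index in H. -/

import Mathlib

namespace SymplecticTransvection

open Matrix

/-- The sign with which the coordinate opposite to `p` enters `form (Pi.single p 1)`. -/
def sgn {l : Type*} : l ⊕ l → ℤ := Sum.elim 1 (-1)

lemma sgn_eq {l : Type*} (p : l ⊕ l) : sgn p = 1 ∨ sgn p = -1 := by
  rcases p with i | i <;> simp [sgn]

section Form

variable {l : Type*} [Fintype l]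

/-- The standard symplectic form on `ℤ^(2l)`. -/
def form (x y : l ⊕ l → ℤ) : ℤ := ∑ i, (x (.inl i) * y (.inr i) - x (.inr i) * y (.inl i))

lemma form_add_left (x y z : l ⊕ l → ℤ) : form (x + y) z = form x z + form y z := by
  simp only [form, Pi.add_apply, ← Finset.sum_add_distrib]
  exact Finset.sum_congr rfl fun i _ => by ring

lemma form_smul_left (c : ℤ) (x z : l ⊕ l → ℤ) : form (c • x) z = c * form x z := by
  simp only [form, Pi.smul_apply, smul_eq_mul, Finset.mul_sum]
  exact Finset.sum_congr rfl fun i _ => by ring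

lemma form_swap (x y : l ⊕ l → ℤ) : form x y = -form y x := by
  simp only [form, ← Finset.sum_neg_distrib]
  exact Finset.sum_congr rfl fun i _ => by ring

lemma form_add_right (x y z : l ⊕ l → ℤ) : form x (y + z) = form x y + form x z := by
  rw [form_swap, form_add_left, form_swap y, form_swap z]; ring

lemma form_smul_right (c : ℤ) (x z : l ⊕ l → ℤ) : form x (c • z) = c * form x z := by
  rw [form_swap, form_smul_left, form_swap z]; ring

lemma form_neg_left (x z : l ⊕ l → ℤ) : form (-x) z = -form x z := by
  simpa using form_smul_left (-1) x z

lemma form_neg_right (x z : l ⊕ l → ℤ) : form x (-z) = -form x z := by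
  simpa using form_smul_right (-1) x z

lemma form_sub_left (x y z : l ⊕ l → ℤ) : form (x - y) z = form x z - form y z := by
  rw [sub_eq_add_neg, form_add_left, form_neg_left, sub_eq_add_neg]

lemma form_sub_right (x y z : l ⊕ l → ℤ) : form x (y - z) = form x y - form x z := by
  rw [sub_eq_add_neg, form_add_right, form_neg_right, sub_eq_add_neg]

@[simp] lemma form_self (x : l ⊕ l → ℤ) : form x x = 0 := by
  have := form_swap x x
  lia

variable [DecidableEq l]

lemma form_single_left (p : l ⊕ l) (x : l ⊕ l → ℤ) :
    form (Pi.single p 1) x = sgn p * x p.swap := by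
  rcases p with i | i <;> simp [form, sgn, Pi.single_apply]

lemma form_single_right (p : l ⊕ l) (x : l ⊕ l → ℤ) :
    form x (Pi.single p 1) = -(sgn p * x p.swap) := by
  rw [form_swap, form_single_left]

lemma form_eq_dotProduct (x y : l ⊕ l → ℤ) : form x y = -(x ⬝ᵥ (J l ℤ *ᵥ y)) := by
  simp [form, J, dotProduct, Matrix.mulVec, fromBlocks, Fintype.sum_sum_type, Matrix.one_apply,
    Finset.sum_sub_distrib]
  ring

end Form

variable {l : Type*} [Fintype l] [DecidableEq l]

lemma mem_symplecticGroup_iff_form {A : Matrix (l ⊕ l) (l ⊕ l) ℤ} :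
    A ∈ symplecticGroup l ℤ ↔ ∀ x y, form (A *ᵥ x) (A *ᵥ y) = form x y := by
  have key : ∀ x y, form (A *ᵥ x) (A *ᵥ y) = -(x ⬝ᵥ ((Aᵀ * J l ℤ * A) *ᵥ y)) := fun x y => by
    rw [form_eq_dotProduct, ← Matrix.mulVec_mulVec, ← Matrix.mulVec_mulVec,
      Matrix.dotProduct_mulVec x, Matrix.vecMul_transpose]
  rw [SymplecticGroup.mem_iff']
  constructor
  · intro h x y
    rw [key, h, form_eq_dotProduct]
  · intro h
    ext p q
    have := h (Pi.single p 1) (Pi.single q 1)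
    rw [key, form_eq_dotProduct] at this
    simpa using this

/-- The action of a symplectic matrix on column vectors. -/
def act (g : symplecticGroup l ℤ) (x : l ⊕ l → ℤ) : l ⊕ l → ℤ := g.1 *ᵥ x

lemma act_one (x : l ⊕ l → ℤ) : act 1 x = x := by simp [act]

lemma act_mul (g h : symplecticGroup l ℤ) (x : l ⊕ l → ℤ) : act (g * h) x = act g (act h x) := by
  simp [act]

lemma act_inv_act (g : symplecticGroup l ℤ) (x : l ⊕ l → ℤ) : act g⁻¹ (act g x) = x := by
  rw [← act_mul, inv_mul_cancel, act_one]

lemma act_act_inv (g : symplecticGroup l ℤ) (x : l ⊕ l → ℤ) : act g (act g⁻¹ x) = x := by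
  rw [← act_mul, mul_inv_cancel, act_one]

lemma act_add (g : symplecticGroup l ℤ) (x y : l ⊕ l → ℤ) : act g (x + y) = act g x + act g y :=
  Matrix.mulVec_add _ _ _

lemma act_smul (g : symplecticGroup l ℤ) (c : ℤ) (x : l ⊕ l → ℤ) : act g (c • x) = c • act g x :=
  Matrix.mulVec_smul _ _ _

lemma form_act (g : symplecticGroup l ℤ) (x y : l ⊕ l → ℤ) :
    form (act g x) (act g y) = form x y :=
  mem_symplecticGroup_iff_form.1 g.2 x y

lemma ext_act {g h : symplecticGroup l ℤ} (H : ∀ x, act g x = act h x) : g = h :=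
  Subtype.ext (Matrix.ext_of_mulVec_single fun i => H (Pi.single i 1))

lemma eq_of_act_single {g h : symplecticGroup l ℤ}
    (H : ∀ p, act g (Pi.single p 1) = act h (Pi.single p 1)) : g = h :=
  Subtype.ext (Matrix.ext_of_mulVec_single H)

/-- The symplectic transvection `x ↦ x + n ω(u, x) u`. -/
def trans (n : ℤ) (u : l ⊕ l → ℤ) : symplecticGroup l ℤ :=
  ⟨1 - n • vecMulVec u (u ᵥ* J l ℤ), by
    have key : ∀ x, (1 - n • vecMulVec u (u ᵥ* J l ℤ)) *ᵥ x = x + (n * form u x) • u := fun x => by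
      rw [form_eq_dotProduct, Matrix.sub_mulVec, Matrix.one_mulVec, Matrix.smul_mulVec,
        Matrix.vecMulVec_mulVec, Matrix.dotProduct_mulVec, op_smul_eq_smul, smul_smul, mul_neg,
        neg_smul, sub_eq_add_neg]
    rw [mem_symplecticGroup_iff_form]
    intro x y
    rw [key, key]
    simp only [form_add_left, form_add_right, form_smul_left, form_smul_right, form_self]
    rw [form_swap x u]
    ring⟩

lemma act_trans (n : ℤ) (u x : l ⊕ l → ℤ) : act (trans n u) x = x + (n * form u x) • u := by
  rw [act, trans, form_eq_dotProduct, Matrix.sub_mulVec, Matrix.one_mulVec, Matrix.smul_mulVec,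
    Matrix.vecMulVec_mulVec, Matrix.dotProduct_mulVec, op_smul_eq_smul, smul_smul, mul_neg,
    neg_smul, sub_eq_add_neg]

lemma trans_zero (u : l ⊕ l → ℤ) : trans 0 u = 1 :=
  ext_act fun x => by simp [act_trans, act_one]

lemma trans_add (n k : ℤ) (u : l ⊕ l → ℤ) : trans (n + k) u = trans n u * trans k u :=
  ext_act fun x => by
    simp only [act_trans, act_mul, form_add_right, form_smul_right, form_self]
    module

lemma trans_neg (n : ℤ) (u : l ⊕ l → ℤ) : trans (-n) u = (trans n u)⁻¹ := by
  rw [eq_inv_iff_mul_eq_one, ← trans_add, neg_add_cancel, trans_zero]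

lemma trans_mul_nat (n : ℤ) (k : ℕ) (u : l ⊕ l → ℤ) : trans (n * k) u = trans n u ^ k := by
  induction k with
  | zero => simp [trans_zero]
  | succ k ih => rw [pow_succ, ← ih, ← trans_add]; push_cast; ring_nf

lemma trans_mul (n k : ℤ) (u : l ⊕ l → ℤ) : trans (n * k) u = trans n u ^ k := by
  obtain ⟨k, rfl | rfl⟩ := k.eq_nat_or_neg
  · rw [trans_mul_nat, zpow_natCast]
  · rw [mul_neg, trans_neg, trans_mul_nat, _root_.zpow_neg, zpow_natCast]

lemma conj_trans (g : symplecticGroup l ℤ) (n : ℤ) (u : l ⊕ l → ℤ) :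
    g * trans n u * g⁻¹ = trans n (act g u) :=
  ext_act fun x => by
    rw [act_mul, act_mul, act_trans, act_trans, act_add, act_act_inv, act_smul]
    rw [← form_act g u, act_act_inv]

lemma trans_smul (n d : ℤ) (u : l ⊕ l → ℤ) : trans n (d • u) = trans (n * d ^ 2) u :=
  ext_act fun x => by
    simp only [act_trans, form_smul_left]
    module

/-- The short-root (Eichler) transformation `x ↦ x + n (ω(u, x) w + ω(w, x) u)` for
orthogonal `u` and `w`. -/
def eichler (n : ℤ) (u w : l ⊕ l → ℤ) : symplecticGroup l ℤ :=
  trans n (u + w) * trans (-n) u * trans (-n) w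

lemma act_eichler (n : ℤ) {u w : l ⊕ l → ℤ} (h : form u w = 0) (x : l ⊕ l → ℤ) :
    act (eichler n u w) x = x + (n * form u x) • w + (n * form w x) • u := by
  have h' : form w u = 0 := by rw [form_swap, h, neg_zero]
  simp only [eichler, act_trans, act_mul, form_add_left, form_add_right, form_smul_right,
    form_self, h, h']
  module

/-- A transvection moving `v` to `w` when `ω(v, w) = ±1`. -/
lemma act_trans_sub {v w : l ⊕ l → ℤ} {c : ℤ} (h : form v w = c) (hc : c * c = 1) :
    act (trans (-c) (w - v)) v = w := by
  rw [act_trans, form_sub_left, form_self, form_swap w v, h]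
  have : -c * (-c - 0) = 1 := by linarith
  rw [this]
  module

section Support

variable {l : Type*}

/-- The hyperbolic plane to which a coordinate belongs. -/
def idx (p : l ⊕ l) : l := p.elim id id

@[simp] lemma idx_swap (p : l ⊕ l) : idx p.swap = idx p := by
  rcases p with i | i <;> rfl

/-- The vectors lying in the hyperbolic planes indexed by `S`. -/
def supported (S : Finset l) : Submodule ℤ (l ⊕ l → ℤ) where
  carrier := {u | ∀ p, idx p ∉ S → u p = 0}
  add_mem' hu hv p hp := by simp [hu p hp, hv p hp]
  zero_mem' _ _ := rfl
  smul_mem' c u hu p hp := by simp [hu p hp]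

variable [DecidableEq l]

/-- The standard basis vectors. -/
abbrev bv (p : l ⊕ l) : l ⊕ l → ℤ := Pi.single p 1

lemma bv_self (p : l ⊕ l) : bv p p = 1 := Pi.single_eq_same _ _

lemma bv_of_ne {p q : l ⊕ l} (h : q ≠ p) : bv p q = 0 := Pi.single_eq_of_ne h _

lemma bv_mem_supported {S : Finset l} {p : l ⊕ l} (hp : idx p ∈ S) : bv p ∈ supported S :=
  fun q hq => bv_of_ne fun h => hq (by rwa [h])

end Support

variable {l : Type*} [Fintype l] [DecidableEq l]

/-- The subgroup generated by the transvections along vectors in the planes indexed by `S`. -/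
def transGroup (S : Finset l) : Subgroup (symplecticGroup l ℤ) :=
  Subgroup.closure {g | ∃ n u, u ∈ supported S ∧ g = trans n u}

lemma trans_mem_transGroup {S : Finset l} (n : ℤ) {u : l ⊕ l → ℤ} (hu : u ∈ supported S) :
    trans n u ∈ transGroup S :=
  Subgroup.subset_closure ⟨n, u, hu, rfl⟩

lemma eichler_mem_transGroup {S : Finset l} (n : ℤ) {u w : l ⊕ l → ℤ} (hu : u ∈ supported S)
    (hw : w ∈ supported S) : eichler n u w ∈ transGroup S :=
  mul_mem (mul_mem (trans_mem_transGroup _ (add_mem hu hw)) (trans_mem_transGroup _ hu))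
    (trans_mem_transGroup _ hw)

lemma act_bv_of_mem_transGroup {S : Finset l} {r : symplecticGroup l ℤ} (hr : r ∈ transGroup S)
    {p : l ⊕ l} (hp : idx p ∉ S) : act r (bv p) = bv p := by
  induction hr using Subgroup.closure_induction with
  | mem g hg =>
    obtain ⟨n, u, hu, rfl⟩ := hg
    rw [act_trans, form_single_right, hu p.swap (by simpa using hp)]
    simp
  | one => exact act_one _
  | mul g h _ _ hg hh => rw [act_mul, hh, hg]
  | inv g _ hg =>
    conv_lhs => rw [← hg]
    exact act_inv_act _ _

lemma act_mem_supported {S : Finset l} {g : symplecticGroup l ℤ}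
    (hg : ∀ p, idx p ∉ S → act g (bv p) = bv p) {v : l ⊕ l → ℤ} (hv : v ∈ supported S) :
    act g v ∈ supported S := by
  intro p hp
  have hp' : idx p.swap ∉ S := by simpa using hp
  have h := form_act g (bv p.swap) v
  rw [hg _ hp', form_single_left, form_single_left, Sum.swap_swap, hv p hp] at h
  rcases sgn_eq p.swap with hs | hs <;> rw [hs] at h <;> lia

lemma act_mem_supported_of_mem {S : Finset l} {r : symplecticGroup l ℤ} (hr : r ∈ transGroup S)
    {v : l ⊕ l → ℤ} (hv : v ∈ supported S) : act r v ∈ supported S :=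
  act_mem_supported (fun _ hp => act_bv_of_mem_transGroup hr hp) hv

/-- The `ℓ¹`-size of an integer vector. -/
def size (v : l ⊕ l → ℤ) : ℕ := ∑ p, (v p).natAbs

lemma size_add_smul_lt {v : l ⊕ l → ℤ} {q : l ⊕ l} {t : ℤ}
    (h : (v q + t).natAbs < (v q).natAbs) : size (v + t • bv q) < size v := by
  refine Finset.sum_lt_sum (fun p _ => ?_) ⟨q, Finset.mem_univ _, by simpa using h⟩
  by_cases hp : p = q
  · subst hp; simpa using h.le
  · simp [Pi.single_eq_of_ne hp]

lemma exists_sign_natAbs_lt {x y : ℤ} (hx : x ≠ 0) (hxy : x.natAbs ≤ y.natAbs) (s : ℤ)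
    (hs : s = 1 ∨ s = -1) : ∃ n : ℤ, (y + n * (s * x)).natAbs < y.natAbs := by
  by_cases h : (0 < x) ↔ (0 < y)
  · refine ⟨-s, ?_⟩
    rcases hs with rfl | rfl <;> ring_nf <;> lia
  · refine ⟨s, ?_⟩
    rcases hs with rfl | rfl <;> ring_nf <;> lia

lemma exists_size_lt_of_swap {S : Finset l} {v : l ⊕ l → ℤ} (hv : v ∈ supported S) {q : l ⊕ l}
    (h₁ : v q ≠ 0) (h₂ : v q.swap ≠ 0) : ∃ r ∈ transGroup S, size (act r v) < size v := by
  wlog h : (v q.swap).natAbs ≤ (v q).natAbs generalizing q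
  · exact this h₂ (by simpa using h₁) (by simpa using (not_le.1 h).le)
  obtain ⟨n, hn⟩ := exists_sign_natAbs_lt h₂ h (sgn q) (sgn_eq q)
  have hq : idx q ∈ S := by
    by_contra hq
    exact h₁ (hv q hq)
  refine ⟨trans n (bv q), trans_mem_transGroup _ (bv_mem_supported hq), ?_⟩
  rw [act_trans, form_single_left]
  exact size_add_smul_lt hn

lemma exists_size_lt {S : Finset l} {v : l ⊕ l → ℤ} (hv : v ∈ supported S) {p q : l ⊕ l}
    (hpq : p ≠ q) (hp : v p ≠ 0) (hq : v q ≠ 0) :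
    ∃ r ∈ transGroup S, size (act r v) < size v := by
  wlog h : (v p).natAbs ≤ (v q).natAbs generalizing p q
  · exact this hpq.symm hq hp (not_le.1 h).le
  by_cases h₂ : v q.swap = 0
  · obtain ⟨n, hn⟩ := exists_sign_natAbs_lt hp h (sgn p.swap) (sgn_eq _)
    have mem : ∀ {p}, v p ≠ 0 → idx p ∈ S := fun {p} hp => by
      by_contra h
      exact hp (hv p h)
    refine ⟨eichler n (bv p.swap) (bv q), eichler_mem_transGroup _
      (bv_mem_supported (by simpa using mem hp)) (bv_mem_supported (mem hq)), ?_⟩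
    rw [act_eichler, form_single_left, form_single_left, h₂, Sum.swap_swap]
    · simpa using size_add_smul_lt hn
    · rw [form_single_left, Sum.swap_swap, bv, Pi.single_eq_of_ne hpq, mul_zero]
  · exact exists_size_lt_of_swap hv hq h₂

lemma exists_act_of_form {S : Finset l} {v w : l ⊕ l → ℤ} (hv : v ∈ supported S)
    (hw : w ∈ supported S) (h : form v w = 1 ∨ form v w = -1) :
    ∃ r ∈ transGroup S, act r v = w :=
  ⟨trans (-form v w) (w - v), trans_mem_transGroup _ (sub_mem hw hv),
    act_trans_sub rfl (by rcases h with h | h <;> simp [h])⟩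

lemma exists_act_bv {S : Finset l} {k : l} (hk : k ∈ S) {p : l ⊕ l} (hp : idx p ∈ S) :
    ∃ r ∈ transGroup S, act r (bv p) = bv (.inl k) := by
  by_cases hpk : idx p = k
  · subst hpk
    rcases p with i | i
    · exact ⟨1, one_mem _, act_one _⟩
    · refine exists_act_of_form (bv_mem_supported hp) (bv_mem_supported hk) ?_
      simp [form_single_left, sgn, idx]
  · have hw : bv p.swap + bv (.inr k) ∈ supported S :=
      add_mem (bv_mem_supported (by simpa using hp)) (bv_mem_supported hk)
    have ne : p.swap ≠ .inr k := fun h => hpk (by rw [← idx_swap, h]; rfl)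
    obtain ⟨r₁, hr₁, h₁⟩ := exists_act_of_form (bv_mem_supported hp) hw (by
      rw [form_single_left, Pi.add_apply, bv_self, bv_of_ne ne]
      simpa using sgn_eq p)
    obtain ⟨r₂, hr₂, h₂⟩ := exists_act_of_form hw (bv_mem_supported (p := .inl k) hk) (by
      rw [form_single_right, Pi.add_apply, Sum.swap_inl, bv_self, bv_of_ne ne.symm]
      simp [sgn])
    exact ⟨r₂ * r₁, mul_mem hr₂ hr₁, by rw [act_mul, h₁, h₂]⟩

/-- Every vector in the planes indexed by `S` can be moved to a multiple of a basis vector. -/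
lemma exists_act_eq_smul {S : Finset l} {k : l} (hk : k ∈ S) (v : l ⊕ l → ℤ)
    (hv : v ∈ supported S) : ∃ r ∈ transGroup S, ∃ d : ℤ, act r v = d • bv (.inl k) := by
  induction hn : size v using Nat.strong_induction_on generalizing v with
  | _ n ih =>
    subst hn
    by_cases H : ∃ p q, p ≠ q ∧ v p ≠ 0 ∧ v q ≠ 0
    · obtain ⟨p, q, hpq, hp, hq⟩ := H
      obtain ⟨r, hr, hlt⟩ := exists_size_lt hv hpq hp hq
      obtain ⟨r', hr', d, hd⟩ := ih _ hlt (act r v) (act_mem_supported_of_mem hr hv) rfl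
      exact ⟨r' * r, mul_mem hr' hr, d, by rw [act_mul, hd]⟩
    · push Not at H
      by_cases h0 : v = 0
      · exact ⟨1, one_mem _, 0, by rw [act_one, h0, zero_smul]⟩
      · obtain ⟨p, hp⟩ := Function.ne_iff.1 h0
        have hvp : v = v p • bv p := by
          funext q
          by_cases hq : p = q
          · subst hq; simp
          · simp [Pi.single_eq_of_ne (Ne.symm hq), H p q hq hp]
        have hpS : idx p ∈ S := by
          by_contra h
          exact hp (hv p h)
        obtain ⟨r, hr, h⟩ := exists_act_bv hk hpS
        exact ⟨r, hr, v p, by rw [hvp, act_smul, h]; simp⟩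

lemma transGroup_mono {S T : Finset l} (h : S ⊆ T) : transGroup S ≤ transGroup T :=
  Subgroup.closure_mono fun _ ⟨n, u, hu, hg⟩ => ⟨n, u, fun p hp => hu p fun hS => hp (h hS), hg⟩

lemma mem_transGroup_of_act_bv (S : Finset l) (g : symplecticGroup l ℤ)
    (hg : ∀ p, idx p ∉ S → act g (bv p) = bv p) : g ∈ transGroup S := by
  induction S using Finset.induction_on generalizing g with
  | empty =>
    have : g = 1 := eq_of_act_single fun p => by rw [act_one]; exact hg p (by simp)
    exact this ▸ one_mem _
  | insert k S hkS ih =>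
    have hk : k ∈ insert k S := Finset.mem_insert_self k S
    have hek : bv (.inl k) ∈ supported (insert k S) := bv_mem_supported (p := .inl k) hk
    have hfk : bv (.inr k) ∈ supported (insert k S) := bv_mem_supported (p := .inr k) hk
    have hef : form (bv (.inl k)) (bv (.inr k)) = 1 := by simp [form_single_left, sgn]
    obtain ⟨r₁, hr₁, d, h₁⟩ := exists_act_eq_smul hk _ (act_mem_supported hg hek)
    have hd : d = 1 ∨ d = -1 := by
      have := form_act (r₁ * g) (bv (.inl k)) (bv (.inr k))
      rw [act_mul, h₁, form_smul_left, hef] at this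
      exact Int.eq_one_or_neg_one_of_mul_eq_one this
    obtain ⟨r₂, hr₂, h₂⟩ := exists_act_of_form (Submodule.smul_mem _ d hek) hfk
      (by rwa [form_smul_left, hef, mul_one])
    obtain ⟨r₃, hr₃, h₃⟩ := exists_act_of_form hfk hek (by rw [form_swap, hef]; simp)
    set g' := r₃ * r₂ * r₁ * g with hg'
    have hr : r₃ * r₂ * r₁ ∈ transGroup (insert k S) := mul_mem (mul_mem hr₃ hr₂) hr₁
    have he' : act g' (bv (.inl k)) = bv (.inl k) := by
      rw [hg', act_mul, act_mul, act_mul, h₁, h₂, h₃]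
    have hfix : ∀ p, idx p ∉ insert k S → act g' (bv p) = bv p := fun p hp => by
      rw [hg', act_mul, hg p hp, act_bv_of_mem_transGroup hr hp]
    set z := act g' (bv (.inr k)) with hz
    have hzS : z ∈ supported (insert k S) := act_mem_supported hfix hfk
    have hez : form (bv (.inl k)) z = 1 := by
      conv_lhs => rw [← he']
      rw [hz, form_act, hef]
    set j := 1 - form z (bv (.inr k)) with hj
    set z' := z + j • bv (.inl k) with hz'
    have hz'S : z' ∈ supported (insert k S) := add_mem hzS (Submodule.smul_mem _ _ hek)
    set s := trans (-1) (bv (.inr k) - z') * trans j (bv (.inl k)) with hs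
    have hsS : s ∈ transGroup (insert k S) :=
      mul_mem (trans_mem_transGroup _ (sub_mem hfk hz'S)) (trans_mem_transGroup _ hek)
    have hse : act s (bv (.inl k)) = bv (.inl k) := by
      rw [hs, act_mul, act_trans j, form_self, mul_zero, zero_smul, add_zero, act_trans,
        form_swap, form_sub_right, hef, hz', form_add_right, hez, form_smul_right, form_self]
      simp
    have hsz : act s z = bv (.inr k) := by
      rw [hs, act_mul, act_trans j, hez, mul_one, ← hz']
      refine act_trans_sub ?_ (one_mul 1)
      rw [hz', form_add_left, form_smul_left, hef, hj]
      ring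
    have hfinal : s * g' ∈ transGroup S := by
      refine ih _ fun p hp => ?_
      by_cases hpk : idx p = k
      · subst hpk
        rcases p with i | i
        · exact (act_mul _ _ _).trans ((congrArg _ he').trans hse)
        · exact (act_mul _ _ _).trans hsz
      · have hp' : idx p ∉ insert k S := by simp [hpk, hp]
        rw [act_mul, hfix p hp', act_bv_of_mem_transGroup hsS hp']
    have := transGroup_mono (Finset.subset_insert k S) hfinal
    rwa [Subgroup.mul_mem_cancel_left _ hsS, hg', Subgroup.mul_mem_cancel_left _ hr] at this

/-- The integral symplectic group is generated by transvections. -/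
lemma transGroup_univ : transGroup (Finset.univ : Finset l) = ⊤ :=
  eq_top_iff.2 fun g _ => mem_transGroup_of_act_bv _ g fun _ hp => absurd (Finset.mem_univ _) hp

/-- Every vector is a multiple of a vector in the orbit of a basis vector. -/
lemma exists_eq_smul_act (k : l) (v : l ⊕ l → ℤ) :
    ∃ (d : ℤ) (g : symplecticGroup l ℤ), v = d • act g (bv (.inl k)) := by
  obtain ⟨r, -, d, h⟩ := exists_act_eq_smul (Finset.mem_univ k) v
    fun _ hp => absurd (Finset.mem_univ _) hp
  exact ⟨d, r⁻¹, by rw [← act_smul, ← h, act_inv_act]⟩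

/-- A normal subgroup containing a multiple of one primitive transvection contains the same
multiple of all transvections. -/
lemma trans_mem_of_normal {K : Subgroup (symplecticGroup l ℤ)} [K.Normal] {N : ℤ} {k : l}
    (hK : trans N (bv (.inl k)) ∈ K) {n : ℤ} (hn : N ∣ n) (u : l ⊕ l → ℤ) : trans n u ∈ K := by
  obtain ⟨d, g, rfl⟩ := exists_eq_smul_act k u
  obtain ⟨c, rfl⟩ := hn
  rw [trans_smul, ← conj_trans, mul_assoc N, trans_mul]
  exact Subgroup.Normal.conj_mem ‹_› _ (zpow_mem hK _) _

lemma normalClosure_trans (k : l) :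
    Subgroup.normalClosure {trans 1 (bv (.inl k))} = (⊤ : Subgroup (symplecticGroup l ℤ)) := by
  rw [eq_top_iff, ← transGroup_univ, transGroup, Subgroup.closure_le]
  rintro _ ⟨n, u, -, rfl⟩
  exact trans_mem_of_normal (Subgroup.subset_normalClosure (Set.mem_singleton _)) (one_dvd n) u

lemma exists_isCoprime_add_mul {a b d : ℤ} (hd : d ≠ 0)
    (h : ∀ p : ℤ, Prime p → p ∣ a → p ∣ b → ¬p ∣ d) : ∃ k, IsCoprime (a + k * b) d := by
  classical
  let s : Finset ℕ := d.natAbs.primeFactors.filter fun p => ¬(p : ℤ) ∣ a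
  refine ⟨∏ p ∈ s, (p : ℤ), isCoprime_of_prime_dvd (fun h0 => hd h0.2) fun p hp h₁ h₂ => ?_⟩
  by_cases hpa : p ∣ a
  · have h₃ : p ∣ (∏ p ∈ s, (p : ℤ)) * b := (dvd_add_right hpa).1 h₁
    rcases hp.dvd_or_dvd h₃ with h₄ | h₄
    · obtain ⟨q, hq, hpq⟩ := (hp.dvd_finsetProd_iff _).1 h₄
      rw [Finset.mem_filter, Nat.mem_primeFactors] at hq
      have : Associated p (q : ℤ) :=
        (Prime.dvd_prime_iff_associated hp (Nat.prime_iff_prime_int.1 hq.1.1)).1 hpq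
      exact hq.2 (this.symm.dvd.trans hpa)
    · exact h p hp hpa h₄ h₂
  · have hmem : p.natAbs ∈ s := by
      rw [Finset.mem_filter, Nat.mem_primeFactors, Int.natAbs_dvd]
      exact ⟨⟨Int.prime_iff_natAbs_prime.1 hp, Int.natAbs_dvd_natAbs.2 h₂, by simpa using hd⟩, hpa⟩
    have h₃ : p ∣ ∏ p ∈ s, (p : ℤ) :=
      (Int.dvd_natAbs_self).trans (Finset.dvd_prod_of_mem (fun p : ℕ => (p : ℤ)) hmem)
    exact hpa ((dvd_add_left (h₃.mul_right b)).1 h₁)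

section Reduction

variable {l : Type*} [DecidableEq l]

/-- The vector with the given coordinates in the hyperbolic planes `i` and `j`. -/
def vec (i j : l) (a b d c : ℤ) : l ⊕ l → ℤ :=
  a • bv (.inl i) + b • bv (.inr i) + d • bv (.inl j) + c • bv (.inr j)

section Vec

variable {i j : l} (a b d c : ℤ)

lemma bv_inl_eq_vec : bv (.inl i) = vec i j 1 0 0 0 := by simp [vec]

lemma vec_add (a' b' d' c' : ℤ) :
    vec i j a b d c + vec i j a' b' d' c' = vec i j (a + a') (b + b') (d + d') (c + c') := by
  simp only [vec]; module

lemma smul_vec (n : ℤ) : n • vec i j a b d c = vec i j (n * a) (n * b) (n * d) (n * c) := by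
  simp only [vec]; module

variable [Fintype l]

lemma form_vec (hij : i ≠ j) (a' b' d' c' : ℤ) :
    form (vec i j a b d c) (vec i j a' b' d' c') = a * b' - b * a' + (d * c' - c * d') := by
  simp only [vec, form_add_left, form_smul_left, form_single_left]
  simp [sgn, hij, hij.symm]
  ring

lemma act_trans_vec (hij : i ≠ j) (n a' b' d' c' : ℤ) :
    act (trans n (vec i j a b d c)) (vec i j a' b' d' c') =
      vec i j (a' + n * (a * b' - b * a' + (d * c' - c * d')) * a)
        (b' + n * (a * b' - b * a' + (d * c' - c * d')) * b)
        (d' + n * (a * b' - b * a' + (d * c' - c * d')) * d)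
        (c' + n * (a * b' - b * a' + (d * c' - c * d')) * c) := by
  rw [act_trans, form_vec _ _ _ _ hij, smul_vec, vec_add]

lemma act_eichler_vec (hij : i ≠ j) (n a₁ b₁ d₁ c₁ s t : ℤ) :
    act (eichler n (vec i j a b 0 0) (vec i j 0 0 s t)) (vec i j a₁ b₁ d₁ c₁) =
      vec i j (a₁ + n * (s * c₁ - t * d₁) * a) (b₁ + n * (s * c₁ - t * d₁) * b)
        (d₁ + n * (a * b₁ - b * a₁) * s) (c₁ + n * (a * b₁ - b * a₁) * t) := by
  rw [act_eichler, form_vec _ _ _ _ hij, form_vec _ _ _ _ hij, smul_vec, smul_vec, vec_add,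
    vec_add]
  · congr 1 <;> ring
  · rw [form_vec _ _ _ _ hij]; ring

end Vec

section Normal

variable [Fintype l] {K : Subgroup (symplecticGroup l ℤ)} {N : ℤ}

lemma eichler_mem (hK : ∀ n u, N ∣ n → trans n u ∈ K) {n : ℤ} (hn : N ∣ n) (u w : l ⊕ l → ℤ) :
    eichler n u w ∈ K :=
  mul_mem (mul_mem (hK _ _ hn) (hK _ _ (by rwa [dvd_neg]))) (hK _ _ (by rwa [dvd_neg]))

/-- Reduction of a unimodular vector congruent to a basis vector in two hyperbolic planes. -/
lemma exists_act_vec_eq {i j : l} (hij : i ≠ j) (hN : ¬IsUnit N)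
    (hK : ∀ n u, N ∣ n → trans n u ∈ K) (a b d : ℤ)
    (hv : ∃ z, form (vec i j (1 + N ^ 2 * a) (N ^ 2 * b) (N ^ 2 * d) 0) z = 1) :
    ∃ h ∈ K, act h (vec i j (1 + N ^ 2 * a) (N ^ 2 * b) (N ^ 2 * d) 0) = bv (.inl i) := by
  wlog hd : d ≠ 0 generalizing d
  · obtain rfl : d = 0 := by simpa using hd
    have ha : 1 + N ^ 2 * a ≠ 0 := fun h0 =>
      hN (IsUnit.of_mul_eq_one (-N * a) (by linarith))
    have hstep : act (eichler (-N ^ 2) (vec i j 0 1 0 0) (vec i j 0 0 1 0))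
        (vec i j (1 + N ^ 2 * a) (N ^ 2 * b) (N ^ 2 * 0) 0) =
        vec i j (1 + N ^ 2 * a) (N ^ 2 * b) (N ^ 2 * (1 + N ^ 2 * a)) 0 := by
      rw [act_eichler_vec _ _ hij]; congr 1 <;> ring
    obtain ⟨z, hz⟩ := hv
    obtain ⟨h, hh, H⟩ := this (1 + N ^ 2 * a) ⟨_, by rw [← hstep, form_act, hz]⟩ ha
    exact ⟨h * _, mul_mem hh (eichler_mem hK (n := -N ^ 2) (by simp [sq]) _ _),
      by rw [act_mul, hstep, H]⟩
  obtain ⟨z, hz⟩ := hv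
  by_cases hN0 : N = 0
  · subst hN0
    exact ⟨1, one_mem _, by simp [vec, act_one]⟩
  obtain ⟨k, hk⟩ : ∃ k, IsCoprime (1 + N ^ 2 * a + k * (N * (N ^ 2 * b))) (N ^ 2 * d) := by
    refine exists_isCoprime_add_mul (mul_ne_zero (pow_ne_zero 2 hN0) hd) fun p hp h₁ h₂ h₃ => ?_
    have hpN : ¬p ∣ N := fun h => hp.not_dvd_one
      ((dvd_add_left ((h.trans (dvd_pow_self N two_ne_zero)).mul_right a)).1 h₁)
    have h₂' := (hp.dvd_or_dvd h₂).resolve_left hpN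
    refine hp.not_dvd_one (hz ▸ ?_)
    rw [vec, form_add_left, form_add_left, form_add_left, form_smul_left, form_smul_left,
      form_smul_left, form_smul_left, zero_mul, add_zero]
    exact dvd_add (dvd_add (h₁.mul_right _) (h₂'.mul_right _)) (h₃.mul_right _)
  obtain ⟨s, t, hst⟩ : IsCoprime (1 + N ^ 2 * (a + k * N * b)) (N * d) := by
    have : 1 + N ^ 2 * (a + k * N * b) = 1 + N ^ 2 * a + k * (N * (N ^ 2 * b)) := by ring
    rw [this]
    exact hk.of_isCoprime_of_dvd_right ⟨N, by ring⟩
  set a' := a + k * N * b with ha'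
  have h₁ : act (trans (k * N) (vec i j 1 0 0 0))
      (vec i j (1 + N ^ 2 * a) (N ^ 2 * b) (N ^ 2 * d) 0) =
      vec i j (1 + N ^ 2 * a') (N ^ 2 * b) (N ^ 2 * d) 0 := by
    rw [act_trans_vec _ _ _ _ hij]; congr 1 <;> ring
  have h₂ : act (eichler (-N) (vec i j 0 1 0 0) (vec i j 0 0 0 1))
      (vec i j (1 + N ^ 2 * a') (N ^ 2 * b) (N ^ 2 * d) 0) =
      vec i j (1 + N ^ 2 * a') (N ^ 2 * (b + N * d)) (N ^ 2 * d) (N * (1 + N ^ 2 * a')) := by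
    rw [act_eichler_vec _ _ hij]; congr 1 <;> ring
  obtain ⟨δ, γ, h₃⟩ : ∃ δ γ, act (eichler N (vec i j 1 0 0 0) (vec i j 0 0 (-a' * s) (a' * t)))
      (vec i j (1 + N ^ 2 * a') (N ^ 2 * (b + N * d)) (N ^ 2 * d) (N * (1 + N ^ 2 * a'))) =
      vec i j 1 (N ^ 2 * (b + N * d)) (N * δ) (N * γ) := by
    refine ⟨N * d - N ^ 2 * (b + N * d) * a' * s,
      1 + N ^ 2 * a' + N ^ 2 * (b + N * d) * a' * t, ?_⟩
    rw [act_eichler_vec _ _ hij]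
    congr 1
    · linear_combination (-N ^ 2 * a') * hst
    all_goals ring
  have h₄ : act (eichler N (vec i j 0 1 0 0) (vec i j 0 0 δ γ))
      (vec i j 1 (N ^ 2 * (b + N * d)) (N * δ) (N * γ)) =
      vec i j 1 (N ^ 2 * (b + N * d)) 0 0 := by
    rw [act_eichler_vec _ _ hij]; congr 1 <;> ring
  have h₅ : act (trans (N ^ 2 * (b + N * d)) (vec i j 0 1 0 0))
      (vec i j 1 (N ^ 2 * (b + N * d)) 0 0) = vec i j 1 0 0 0 := by
    rw [act_trans_vec _ _ _ _ hij]; congr 1 <;> ring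
  have step : ∀ {g : symplecticGroup l ℤ} {v w}, g ∈ K → act g v = w →
      (∃ h ∈ K, act h w = bv (.inl i)) → ∃ h ∈ K, act h v = bv (.inl i) := by
    rintro g v w hg rfl ⟨h, hh, H⟩
    exact ⟨h * g, mul_mem hh hg, by rw [act_mul, H]⟩
  exact step (hK _ _ (Dvd.intro_left k rfl)) h₁
    (step (eichler_mem hK (dvd_neg.2 dvd_rfl) _ _) h₂
    (step (eichler_mem hK dvd_rfl _ _) h₃ (step (eichler_mem hK dvd_rfl _ _) h₄
    (step (hK _ _ ⟨N * (b + N * d), by ring⟩) h₅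
      ⟨1, one_mem _, by rw [act_one, ← bv_inl_eq_vec]⟩))))

/-- The stabilising normal subgroup acts transitively on the unimodular vectors congruent to a
basis vector modulo the square of the level. -/
lemma exists_act_eq_bv [K.Normal] {i j : l} (hij : i ≠ j) (hN : ¬IsUnit N)
    (hK : ∀ n u, N ∣ n → trans n u ∈ K) (g : symplecticGroup l ℤ) (x : l ⊕ l → ℤ)
    (hg : act g (bv (.inl i)) = bv (.inl i) + N ^ 2 • x) :
    ∃ h ∈ K, act h (act g (bv (.inl i))) = bv (.inl i) := by
  set S := Finset.univ.erase i with hS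
  have hi : i ∉ S := by simp [hS]
  set y := x - x (.inl i) • bv (.inl i) - x (.inr i) • bv (.inr i) with hy
  have hyS : y ∈ supported S := by
    intro p hp
    have : idx p = i := by simpa [hS] using hp
    rcases p with q | q <;> obtain rfl : q = i := this <;> simp [hy]
  obtain ⟨r, hr, d, hd⟩ := exists_act_eq_smul (k := j) (by simp [hS, hij.symm]) y hyS
  have hrp : ∀ p, idx p = i → act r (bv p) = bv p := fun p hp =>
    act_bv_of_mem_transGroup hr (by rwa [hp])
  have hx : x = x (.inl i) • bv (.inl i) + x (.inr i) • bv (.inr i) + y := by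
    rw [hy]; module
  have hrv : act r (act g (bv (.inl i))) =
      vec i j (1 + N ^ 2 * x (.inl i)) (N ^ 2 * x (.inr i)) (N ^ 2 * d) 0 := by
    rw [hg, act_add, act_smul]
    conv_lhs => rw [hx]
    rw [act_add, act_add, act_smul, act_smul, hd, hrp _ rfl, hrp _ rfl, vec]
    module
  obtain ⟨h, hh, H⟩ := exists_act_vec_eq hij hN hK (x (.inl i)) (x (.inr i)) d
    ⟨act r (act g (bv (.inr i))), by
      rw [← hrv, form_act, form_act]; simp [form_single_left, sgn]⟩
  refine ⟨r⁻¹ * h * r, Subgroup.Normal.conj_mem' ‹_› _ hh _, ?_⟩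
  rw [act_mul, act_mul, hrv, H]
  conv_lhs => rw [← hrp (.inl i) rfl]
  exact act_inv_act _ _

end Normal

end Reduction

section FiniteIndex

variable {l : Type*} [Fintype l] [DecidableEq l]

lemma trans_mem_commutator {A B : Subgroup (symplecticGroup l ℤ)} [A.Normal] [B.Normal] {i j : l}
    (hij : i ≠ j) {a b : ℤ} (ha : trans a (bv (.inl i)) ∈ A) (hb : trans b (bv (.inl i)) ∈ B) :
    trans (2 * a ^ 2 * b) (bv (.inl i)) ∈ ⁅A, B⁆ := by
  have hij' : form (bv (.inl i)) (bv (.inl j)) = 0 := by simp [form_single_left]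
  have hif : form (bv (.inl i)) (bv (.inr j)) = 0 := by
    simp [form_single_left, hij.symm]
  have hjf : form (bv (.inl j)) (bv (.inr j)) = 1 := by
    simp [form_single_left, sgn]
  have hT : trans b (bv (.inr j)) ∈ B := trans_mem_of_normal hb dvd_rfl _
  have key : ∀ c, a ∣ c → trans b (bv (.inr j) + c • bv (.inl i)) * trans (-b) (bv (.inr j)) ∈
      ⁅A, B⁆ := fun c hc => by
    have := Subgroup.commutator_mem_commutator (eichler_mem (fun n u hn =>
      trans_mem_of_normal ha hn u) hc (bv (.inl i)) (bv (.inl j))) hT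
    rwa [commutatorElement_def, conj_trans, act_eichler _ hij', hif, hjf, mul_zero, zero_smul,
      add_zero, mul_one, ← trans_neg] at this
  have := mul_mem (key a dvd_rfl) (key (-a) (by simp))
  convert this using 1
  have hfi : form (bv (.inr j)) (bv (.inl i)) = 0 := by rw [form_swap, hif, neg_zero]
  refine ext_act fun x => ?_
  simp only [act_trans, act_mul, form_add_left, form_add_right, form_smul_right, form_smul_left,
    form_self, hif, hfi]
  module

lemma normal_lowerCentralSeries {G : Type*} [Group G] (S : Subgroup G) [S.Normal] (n : ℕ) :
    (S.lowerCentralSeries n).Normal := by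
  induction n with
  | zero => simpa
  | succ n ih => rw [Subgroup.lowerCentralSeries_succ]; exact Subgroup.commutator_normal _ _

lemma exists_trans_mem_lowerCentralSeries (S : Subgroup (symplecticGroup l ℤ)) [S.Normal]
    [S.FiniteIndex] {i j : l} (hij : i ≠ j) (n : ℕ) :
    ∃ N : ℕ, 0 < N ∧ trans (N : ℤ) (bv (.inl i)) ∈ S.lowerCentralSeries n := by
  obtain ⟨M, hM, -, h⟩ := Subgroup.exists_pow_mem_of_index_ne_zero
    (Subgroup.FiniteIndex.index_ne_zero (H := S)) (trans 1 (bv (.inl i)))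
  rw [← trans_mul_nat, one_mul] at h
  induction n with
  | zero => exact ⟨M, hM, by simpa⟩
  | succ n ih =>
    obtain ⟨N, hN, hmem⟩ := ih
    have := normal_lowerCentralSeries S n
    refine ⟨2 * N ^ 2 * M, by positivity, ?_⟩
    rw [Subgroup.lowerCentralSeries_succ]
    exact_mod_cast trans_mem_commutator hij hmem h

/-- A group with centre of finite index that is the normal closure of a torsion element is
finite. -/
lemma finite_of_finiteIndex_center {Q : Type*} [Group Q] [(Subgroup.center Q).FiniteIndex] {t : Q}
    (ht : Subgroup.normalClosure {t} = ⊤) (hfin : IsOfFinOrder t) : Finite Q := by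
  have hcomm : (commutatorSet Q).Finite := by
    refine (Set.finite_range fun x : (Q ⧸ Subgroup.center Q) × (Q ⧸ Subgroup.center Q) =>
      x.1.out * x.2.out * x.1.out⁻¹ * x.2.out⁻¹).subset ?_
    rintro _ ⟨g, h, rfl⟩
    refine ⟨(g, h), ?_⟩
    obtain ⟨⟨y, hy⟩, hg⟩ := QuotientGroup.mk_out_eq_mul (Subgroup.center Q) g
    obtain ⟨⟨z, hz⟩, hh⟩ := QuotientGroup.mk_out_eq_mul (Subgroup.center Q) h
    rw [Subgroup.mem_center_iff] at hy hz
    simp only [hg, hh, commutatorElement_def, _root_.mul_inv_rev]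
    have e : g * y * (h * z) * (y⁻¹ * g⁻¹) * (z⁻¹ * h⁻¹) =
        g * (y * (h * z)) * y⁻¹ * (g⁻¹ * z⁻¹) * h⁻¹ := by group
    have hz' : g⁻¹ * z⁻¹ = z⁻¹ * g⁻¹ := by
      rw [← _root_.mul_inv_rev, ← hz, _root_.mul_inv_rev]
    rw [e, ← hy, hz']
    group
  have := hcomm.to_subtype
  have hzp : Subgroup.zpowers (Abelianization.of t) = ⊤ := by
    have hsurj : Function.Surjective (Abelianization.of (G := Q)) :=
      QuotientGroup.mk'_surjective _
    rw [eq_top_iff, ← Subgroup.map_top_of_surjective _ hsurj, ← ht,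
      Subgroup.map_le_iff_le_comap]
    exact Subgroup.normalClosure_le_normal (by simp)
  have : Finite (Abelianization Q) := by
    have := finite_zpowers.2 (Abelianization.of.isOfFinOrder hfin)
    rw [hzp] at this
    exact Set.finite_univ_iff.1 this
  exact (Subgroup.finite_iff_finite_and_finiteIndex (_root_.commutator Q)).2
    ⟨inferInstance, @Subgroup.finiteIndex_of_finite_quotient _ _ _ this⟩

/-- The principal congruence subgroup. -/
def congruenceSubgroup (l : Type*) [Fintype l] [DecidableEq l] (q : ℕ) :
    Subgroup (symplecticGroup l ℤ) :=
  ((Int.castRingHom (ZMod q)).mapMatrix.toMonoidHom.comp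
    (symplecticGroup l ℤ).subtype).toHomUnits.ker

instance (q : ℕ) [NeZero q] : (congruenceSubgroup l q).FiniteIndex :=
  Subgroup.finiteIndex_ker _

lemma exists_act_eq_add_smul {q : ℕ} {g : symplecticGroup l ℤ} (hg : g ∈ congruenceSubgroup l q)
    (p : l ⊕ l) : ∃ x, act g (bv p) = bv p + (q : ℤ) • x := by
  have h : g.1.map (Int.castRingHom (ZMod q)) = 1 := congrArg Units.val hg
  have hdvd : ∀ r, (q : ℤ) ∣ act g (bv p) r - bv p r := fun r => by
    rw [← (ZMod.intCast_zmod_eq_zero_iff_dvd _ q)]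
    have := congrFun (congrFun h r) p
    simp only [map_apply, one_apply, eq_intCast] at this
    simp [act, this, Pi.single_apply]
  choose x hx using hdvd
  exact ⟨x, funext fun r => by simp [← hx]⟩

lemma finiteIndex_of_trans_mem {K : Subgroup (symplecticGroup l ℤ)} [K.Normal] {i j : l}
    (hij : i ≠ j) {N : ℕ} (hN : 0 < N) (hK : trans (N : ℤ) (bv (.inl i)) ∈ K) :
    K.FiniteIndex := by
  wlog hN2 : 2 ≤ N generalizing N
  · refine this (N := N * 2) (by positivity) ?_ (by omega)
    push_cast
    rw [trans_mul]
    exact zpow_mem hK _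
  have hu : ¬IsUnit (N : ℤ) := by
    rw [Int.isUnit_iff]; omega
  have : NeZero (N ^ 2) := ⟨by positivity⟩
  set T : symplecticGroup l ℤ := trans 1 (bv (.inl i)) with hT
  have hnc : Subgroup.normalClosure {(T : symplecticGroup l ℤ ⧸ K)} = ⊤ := by
    change Subgroup.normalClosure {QuotientGroup.mk' K T} = ⊤
    rw [← Set.image_singleton, ← Subgroup.map_normalClosure _ _ (QuotientGroup.mk'_surjective K), normalClosure_trans,
      Subgroup.map_top_of_surjective _ (QuotientGroup.mk'_surjective K)]
  have hcomm : ∀ γ ∈ congruenceSubgroup l (N ^ 2), Commute (γ : symplecticGroup l ℤ ⧸ K) T := by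
    intro γ hγ
    obtain ⟨x, hx⟩ := exists_act_eq_add_smul hγ (.inl i)
    obtain ⟨h, hh, H⟩ := exists_act_eq_bv hij hu (fun n u hn => trans_mem_of_normal hK hn u) γ x
      (by rw [hx]; push_cast; rfl)
    rw [← act_mul] at H
    have := conj_trans (h * γ) 1 (bv (.inl i))
    rw [H, mul_inv_eq_iff_eq_mul] at this
    have := congrArg (QuotientGroup.mk' K) this
    have h1 : ((h : symplecticGroup l ℤ) : symplecticGroup l ℤ ⧸ K) = 1 :=
      (QuotientGroup.eq_one_iff h).2 hh
    simpa [h1, T, commute_iff_eq] using this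
  have hnorm : ((congruenceSubgroup l (N ^ 2)).map (QuotientGroup.mk' K)).Normal :=
    Subgroup.Normal.map (MonoidHom.normal_ker _) _ (QuotientGroup.mk'_surjective K)
  have hle : (congruenceSubgroup l (N ^ 2)).map (QuotientGroup.mk' K) ≤ Subgroup.center _ := by
    rw [← Subgroup.centralizer_univ, ← Subgroup.coe_top, Subgroup.le_centralizer_iff, ← hnc]
    refine Subgroup.normalClosure_le_normal (Set.singleton_subset_iff.2 ?_)
    rintro _ ⟨γ, hγ, rfl⟩
    exact hcomm γ hγ
  have : ((congruenceSubgroup l (N ^ 2)).map (QuotientGroup.mk' K)).FiniteIndex :=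
    ⟨fun h0 => Subgroup.FiniteIndex.index_ne_zero (H := congruenceSubgroup l (N ^ 2))
      (zero_dvd_iff.1 (h0 ▸ Subgroup.index_map_dvd _ (QuotientGroup.mk'_surjective K)))⟩
  have := Subgroup.finiteIndex_of_le hle
  have hfin : IsOfFinOrder (T : symplecticGroup l ℤ ⧸ K) :=
    isOfFinOrder_iff_pow_eq_one.2 ⟨N, hN, by
      rw [← QuotientGroup.mk_pow, QuotientGroup.eq_one_iff, ← trans_mul_nat, one_mul]
      exact hK⟩
  have := finite_of_finiteIndex_center hnc hfin
  exact Subgroup.finiteIndex_of_finite_quotient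

lemma finiteIndex_lowerCentralSeries (S : Subgroup (symplecticGroup l ℤ)) [S.FiniteIndex]
    [Nontrivial l] (n : ℕ) : (S.lowerCentralSeries n).FiniteIndex := by
  obtain ⟨i, j, hij⟩ := exists_pair_ne l
  obtain ⟨N, hN, h⟩ := exists_trans_mem_lowerCentralSeries S.normalCore hij n
  have := normal_lowerCentralSeries S.normalCore n
  have := finiteIndex_of_trans_mem hij hN h
  exact Subgroup.finiteIndex_of_le (Subgroup.lowerCentralSeries_mono n S.normalCore_le)

end FiniteIndex

end SymplecticTransvection

theorem conilpotent_finite_index_in_PSp (m : ℕ) (hm : 2 ≤ m)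
    (H : Subgroup (Matrix.symplecticGroup (Fin m) ℤ ⧸
        Subgroup.center (Matrix.symplecticGroup (Fin m) ℤ)))
    (hH : H.FiniteIndex) (L : Subgroup H) [L.Normal]
    (hnil : Group.IsNilpotent (H ⧸ L)) : L.FiniteIndex := by
  obtain ⟨c, hc⟩ := Subgroup.nilpotent_iff_lowerCentralSeries.1 hnil
  have : Nontrivial (Fin m) := Fin.nontrivial_iff_two_le.2 hm
  let π := QuotientGroup.mk' (Subgroup.center (Matrix.symplecticGroup (Fin m) ℤ))
  have hπ : Function.Surjective π := QuotientGroup.mk'_surjective _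
  have hcomap : (H.comap π).FiniteIndex :=
    ⟨by rw [Subgroup.index_comap_of_surjective _ hπ]; exact hH.index_ne_zero⟩
  have hfi := SymplecticTransvection.finiteIndex_lowerCentralSeries (H.comap π) c
  have hle : Subgroup.lowerCentralSeries (⊤ : Subgroup H) c ≤ L := by
    rw [← QuotientGroup.ker_mk' L, ← Subgroup.map_eq_bot_iff, Subgroup.map_lowerCentralSeries,
      Subgroup.map_top_of_surjective _ (QuotientGroup.mk'_surjective L), hc]
  have hfi' : (H.lowerCentralSeries c).FiniteIndex := by
    rw [← Subgroup.map_comap_eq_self_of_surjective hπ H, ← Subgroup.map_lowerCentralSeries]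
    exact ⟨fun h0 => hfi.index_ne_zero (zero_dvd_iff.1 (h0 ▸ Subgroup.index_map_dvd _ hπ))⟩
  have : (Subgroup.lowerCentralSeries (⊤ : Subgroup H) c).FiniteIndex := by
    rw [← Subgroup.comap_map_eq_self_of_injective H.subtype_injective
      (Subgroup.lowerCentralSeries ⊤ c), Subgroup.top_subtype_lowerCentralSeries]
    exact Subgroup.instFiniteIndex_subgroupOf _ _
  exact Subgroup.finiteIndex_of_le hle
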